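/- Let F be a probability measure on ℝ that belongs to the strict domain of attraction of a stable probability measure with characteristic exponent 1, i.e. there is a probability measure S on ℝ such that (φ_F(s/n))ⁿ → φ_S(s) as n → ∞ for every s ∈ ℝ. Then the laws F⁽ⁿ⁾ of the arithmetic means of 2ⁿ i.i.d. random variables with law F (the pushforwards of F^{∗2ⁿ} under x ↦ x/2ⁿ) converge weakly to S, and S is a Cauchy-type probability distribution: there exist c ≥ 0 and m ∈ ℝ such that φ_S(s) = exp(−c|s| + i m s) for all s ∈ ℝ. -/

import Mathlib

open MeasureTheory Filter Topology

/-- The characteristic function of a finite Borel measure on `ℝ`. -/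
noncomputable def charFnR (H : Measure ℝ) (s : ℝ) : ℂ :=
  ∫ x, Complex.exp (((s * x : ℝ) : ℂ) * Complex.I) ∂H

/-- `convPowR F k` is the `k`-fold convolution power `F^{∗k}` (with `F^{∗0} = δ₀`). -/
noncomputable def convPowR (F : Measure ℝ) : ℕ → Measure ℝ
  | 0 => Measure.dirac 0
  | k + 1 => (convPowR F k).conv F

/-- The law `F⁽ⁿ⁾` of the arithmetic mean of `2ⁿ` i.i.d. random variables with law `F`. -/
noncomputable def meanLaw (F : Measure ℝ) (n : ℕ) : Measure ℝ :=
  (convPowR F (2 ^ n)).map (fun x => x / 2 ^ n)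

/-- Weak convergence of a sequence of measures. -/
def WeakTendsto {E : Type*} [MeasurableSpace E] [TopologicalSpace E]
    (μ : ℕ → Measure E) (ν : Measure E) : Prop :=
  ∀ f : BoundedContinuousFunction E ℝ,
    Tendsto (fun n => ∫ x, f x ∂(μ n)) atTop (𝓝 (∫ x, f x ∂ν))

theorem charFnR_eq_charFun (H : Measure ℝ) (s : ℝ) : charFnR H s = charFun H s := by
  rw [charFnR, charFun_apply_real]
  push_cast
  rfl

theorem convPowR_prob (F : Measure ℝ) [IsProbabilityMeasure F] (k : ℕ) :
    IsProbabilityMeasure (convPowR F k) := by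
  induction k with
  | zero => rw [convPowR]; infer_instance
  | succ k ih => rw [convPowR]; infer_instance

theorem charFun_convPowR (F : Measure ℝ) [IsProbabilityMeasure F] (k : ℕ) (s : ℝ) :
    charFun (convPowR F k) s = (charFun F s) ^ k := by
  induction k with
  | zero => rw [convPowR]; simp
  | succ k ih =>
    have := convPowR_prob F k
    rw [convPowR, charFun_conv, ih, pow_succ]

theorem meanLaw_prob (F : Measure ℝ) [IsProbabilityMeasure F] (n : ℕ) :
    IsProbabilityMeasure (meanLaw F n) := by
  have := convPowR_prob F (2 ^ n)
  exact Measure.isProbabilityMeasure_map (by fun_prop)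

theorem charFun_meanLaw (F : Measure ℝ) [IsProbabilityMeasure F] (n : ℕ) (s : ℝ) :
    charFun (meanLaw F n) s = (charFun F (s / ((2 ^ n : ℕ) : ℝ))) ^ (2 ^ n) := by
  have h : (fun x : ℝ => x / 2 ^ n) = fun x => ((2 : ℝ) ^ n)⁻¹ * x := by
    ext x; rw [div_eq_inv_mul]
  rw [meanLaw, h, charFun_map_mul, charFun_convPowR]
  congr 2
  push_cast
  rw [div_eq_inv_mul]

theorem exp_of_pow (φ : ℝ → ℂ) (hc : Continuous φ) (h0 : φ 0 = 1)
    (hpow : ∀ (k : ℕ) (s : ℝ), φ (k * s) = φ s ^ k) :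
    ∃ z : ℂ, ∀ s : ℝ, 0 ≤ s → φ s = Complex.exp (s * z) := by
  have h1 : ∀ᶠ u in 𝓝 (0 : ℝ), 0 < (φ u).re := by
    have : Tendsto (fun u => (φ u).re) (𝓝 0) (𝓝 ((φ 0).re)) :=
      (Complex.continuous_re.comp hc).tendsto 0
    apply this.eventually_const_lt
    simp [h0]
  obtain ⟨δ', hδ', hb⟩ := Metric.eventually_nhds_iff.1 h1
  set δ := δ' / 2 with hδ
  have hδ0 : 0 < δ := by positivity
  have hre : ∀ n : ℕ, 0 < (φ (δ / 2 ^ n)).re := by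
    intro n
    apply hb
    have h2 : δ / 2 ^ n ≤ δ := div_le_self hδ0.le (one_le_pow₀ (by norm_num))
    have h3 : 0 ≤ δ / 2 ^ n := by positivity
    rw [Real.dist_eq, sub_zero, abs_of_nonneg h3]
    linarith
  have hne : ∀ n : ℕ, φ (δ / 2 ^ n) ≠ 0 := by
    intro n h
    have := hre n
    simp [h] at this
  have hstep : ∀ n : ℕ, Complex.log (φ (δ / 2 ^ n)) = 2 * Complex.log (φ (δ / 2 ^ (n + 1))) := by
    intro n
    have e : φ (δ / 2 ^ n) = φ (δ / 2 ^ (n + 1)) ^ 2 := by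
      rw [← hpow]; congr 1; push_cast; field_simp; ring
    have ha : |(φ (δ / 2 ^ (n + 1))).arg| < Real.pi / 2 :=
      Complex.abs_arg_lt_pi_div_two_iff.2 (Or.inl (hre _))
    rw [abs_lt] at ha
    have e2 : φ (δ / 2 ^ (n + 1)) ^ 2 = Complex.exp (2 * Complex.log (φ (δ / 2 ^ (n + 1)))) := by
      rw [two_mul, Complex.exp_add, Complex.exp_log (hne _), sq]
    rw [e, e2, Complex.log_exp]
    · simp [Complex.log_im]; linarith
    · simp [Complex.log_im]; linarith
  set w := Complex.log (φ δ) with hw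
  have hlog : ∀ n : ℕ, Complex.log (φ (δ / 2 ^ n)) = w / 2 ^ n := by
    intro n
    induction n with
    | zero => simp [hw]
    | succ n ih =>
      have := hstep n
      rw [ih] at this
      have h5 : w / 2 ^ (n + 1) = (w / 2 ^ n) / 2 := by rw [pow_succ, div_div]
      rw [h5, this]; ring
  have hdy : ∀ (k n : ℕ), φ (k / 2 ^ n * δ) = Complex.exp (((k / 2 ^ n : ℝ) : ℂ) * w) := by
    intro k n
    have : (k / 2 ^ n * δ : ℝ) = k * (δ / 2 ^ n) := by ring
    rw [this, hpow, ← Complex.exp_log (hne n), hlog, ← Complex.exp_nat_mul]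
    congr 1; push_cast; ring
  have hall : ∀ t : ℝ, 0 ≤ t → φ (t * δ) = Complex.exp ((t : ℂ) * w) := by
    intro t ht
    have hfl : Tendsto (fun n : ℕ => ((⌊t * 2 ^ n⌋₊ : ℝ) / 2 ^ n)) atTop (𝓝 t) :=
      (tendsto_nat_floor_mul_div_atTop ht).comp
        (tendsto_pow_atTop_atTop_of_one_lt (by norm_num : (1 : ℝ) < 2))
    have a1 : Tendsto (fun n : ℕ => φ ((⌊t * 2 ^ n⌋₊ : ℝ) / 2 ^ n * δ)) atTop (𝓝 (φ (t * δ))) :=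
      (hc.tendsto _).comp (hfl.mul_const δ)
    have hc2 : Continuous (fun t : ℝ => Complex.exp ((t : ℂ) * w)) := by fun_prop
    have a2 := (hc2.tendsto t).comp hfl
    refine tendsto_nhds_unique a1 (a2.congr fun n => ?_)
    rw [hdy]; rfl
  refine ⟨w / δ, fun s hs => ?_⟩
  have := hall (s / δ) (by positivity)
  rw [div_mul_cancel₀ _ hδ0.ne'] at this
  rw [this]
  congr 1; push_cast; ring

/-- If `F` is in the strict domain of attraction of a stable law `S` with characteristic
exponent 1, then the laws of the arithmetic means converge weakly to `S`, and `S` is a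
Cauchy-type distribution. -/
theorem domain_of_attraction_cauchy (F S : Measure ℝ)
    [IsProbabilityMeasure F] [IsProbabilityMeasure S]
    (hattr : ∀ s : ℝ,
      Tendsto (fun n : ℕ => (charFnR F (s / n)) ^ n) atTop (𝓝 (charFnR S s))) :
    WeakTendsto (fun n => meanLaw F n) S ∧
      ∃ c : ℝ, 0 ≤ c ∧ ∃ m : ℝ, ∀ s : ℝ,
        charFnR S s = Complex.exp (((-(c * |s|) : ℝ) : ℂ) + ((m * s : ℝ) : ℂ) * Complex.I) := by
  simp only [charFnR_eq_charFun] at hattr ⊢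
  constructor
  · have hp := fun n => meanLaw_prob F n
    intro f
    have key : Tendsto (β := ProbabilityMeasure ℝ) (fun n => ⟨meanLaw F n, hp n⟩) atTop
        (𝓝 ⟨S, inferInstance⟩) := by
      apply ProbabilityMeasure.tendsto_of_tendsto_charFun
      intro s
      have h2 : Tendsto (fun n : ℕ => 2 ^ n) atTop atTop :=
        tendsto_pow_atTop_atTop_of_one_lt (by norm_num)
      exact ((hattr s).comp h2).congr fun n => (charFun_meanLaw F n s).symm
    exact ProbabilityMeasure.tendsto_iff_forall_integral_tendsto.1 key f
  · have hpow : ∀ (k : ℕ) (s : ℝ), charFun S (k * s) = charFun S s ^ k := by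
      intro k s
      rcases Nat.eq_zero_or_pos k with rfl | hk
      · simp
      have h2 : Tendsto (fun n : ℕ => k * n) atTop atTop :=
        tendsto_id.const_mul_atTop' hk
      have a1 := (hattr (k * s)).comp h2
      have a2 := (hattr s).pow k
      refine tendsto_nhds_unique a1 (a2.congr fun n => ?_)
      have hk' : (k : ℝ) ≠ 0 := by positivity
      simp only [Function.comp]
      rw [← pow_mul, mul_comm n k]
      congr 2
      push_cast
      rw [mul_div_mul_left _ _ hk']
    obtain ⟨z, hz⟩ := exp_of_pow (charFun S) continuous_charFun (by simp) hpow
    have hn : z.re ≤ 0 := by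
      have := norm_charFun_le_one (μ := S) (1 : ℝ)
      rw [hz 1 zero_le_one, Complex.norm_exp] at this
      simpa using this
    have hpos : ∀ s : ℝ, 0 ≤ s → charFun S s =
        Complex.exp (((-(-z.re * |s|) : ℝ) : ℂ) + ((z.im * s : ℝ) : ℂ) * Complex.I) := by
      intro s hs
      rw [hz s hs, abs_of_nonneg hs]
      congr 1
      apply Complex.ext <;> simp <;> ring
    refine ⟨-z.re, by linarith, z.im, fun s => ?_⟩
    rcases le_total 0 s with hs | hs
    · exact hpos s hs
    · have := hpos (-s) (by linarith)
      rw [charFun_neg] at this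
      have h3 := congrArg (starRingEnd ℂ) this
      rw [Complex.conj_conj, ← Complex.exp_conj] at h3
      rw [h3, abs_neg]
      congr 1
      apply Complex.ext <;> simp
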